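/- Let σ² > 0 and D > 0. On a probability space with measure 𝒫, let X be a real Gaussian random variable with mean 0 and variance σ², and let X̂ be a square-integrable real random variable such that E[X̂ | X] = X almost surely and E[(X̂ − X)²] ≤ D. Then the Kullback–Leibler divergence of the joint law of (X, X̂) (the pushforward of 𝒫 under ω ↦ (X(ω), X̂(ω))) from the product of the marginal laws (𝒫.map X) × (𝒫.map X̂) is at least (1/2)·ln(1 + σ²/D). -/

import Mathlib

open MeasureTheory ProbabilityTheory

/-- The Kullback–Leibler divergence of `μ` from `ν`: `∫ log (dμ/dν) dμ` when
`μ ≪ ν` (and the log-likelihood ratio is integrable), and `+∞` otherwise. -/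
noncomputable def klDiv {α : Type*} [MeasurableSpace α] (μ ν : Measure α) : EReal :=
  open Classical in
  if μ ≪ ν ∧ Integrable (llr μ ν) μ then ((∫ x, llr μ ν x ∂μ : ℝ) : EReal) else ⊤

open scoped NNReal ENNReal

/-- The **Donsker–Varadhan inequality**. -/
theorem integral_sub_log_integral_exp_le_integral_llr {α : Type*} [MeasurableSpace α]
    {μ ν : Measure α} [IsProbabilityMeasure μ] [IsProbabilityMeasure ν] {f : α → ℝ}
    (hμν : μ ≪ ν) (h_int : Integrable (llr μ ν) μ) (hfμ : Integrable f μ)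
    (hfν : Integrable (fun x ↦ Real.exp (f x)) ν) :
    ∫ x, f x ∂μ - Real.log (∫ x, Real.exp (f x) ∂ν) ≤ ∫ x, llr μ ν x ∂μ := by
  have := isProbabilityMeasure_tilted hfν
  have h := InformationTheory.integral_llr_add_sub_measure_univ_nonneg
    (hμν.trans (absolutelyContinuous_tilted hfν))
    (integrable_llr_tilted_right hμν hfμ h_int hfν)
  rw [integral_llr_tilted_right hμν hfμ hfν h_int] at h
  simp only [probReal_univ] at h
  linarith

/-- The log-likelihood ratio of the Gaussian laws `N(m, w)` and `N(0, v)`. -/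
noncomputable def gaussianLogRatio (v w m x : ℝ) : ℝ :=
  Real.log (v / w) / 2 - (x - m) ^ 2 / (2 * w) + x ^ 2 / (2 * v)

theorem gaussianPDFReal_mul_exp_gaussianLogRatio {v w : ℝ≥0} (hv : v ≠ 0) (hw : w ≠ 0) (m x : ℝ) :
    gaussianPDFReal 0 v x * Real.exp (gaussianLogRatio v w m x) = gaussianPDFReal m w x := by
  have hv' : (0 : ℝ) < v := by positivity
  have hw' : (0 : ℝ) < w := by positivity
  have hs : Real.exp (Real.log (v / w) / 2) = √v / √w := by
    rw [← Real.log_sqrt (by positivity), Real.exp_log (by positivity),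
      Real.sqrt_div (by positivity)]
  have hsplit : gaussianLogRatio v w m x =
      Real.log (v / w) / 2 + (-(x - m) ^ 2 / (2 * w) - -(x - 0) ^ 2 / (2 * v)) := by
    rw [gaussianLogRatio]; ring
  rw [hsplit, Real.exp_add, Real.exp_sub, hs]
  simp only [gaussianPDFReal]
  rw [Real.sqrt_mul (by positivity) (v : ℝ), Real.sqrt_mul (by positivity) (w : ℝ)]
  field_simp

theorem lintegral_exp_gaussianLogRatio {v w : ℝ≥0} (hv : v ≠ 0) (hw : w ≠ 0) (m : ℝ) :
    ∫⁻ x, ENNReal.ofReal (Real.exp (gaussianLogRatio v w m x)) ∂(gaussianReal 0 v) = 1 := by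
  rw [gaussianReal_of_var_ne_zero _ hv,
    lintegral_withDensity_eq_lintegral_mul _ (measurable_gaussianPDF _ _)
      (by unfold gaussianLogRatio; fun_prop),
    ← lintegral_gaussianPDF_eq_one m hw]
  refine lintegral_congr fun x ↦ ?_
  simp only [Pi.mul_apply, gaussianPDF]
  rw [← ENNReal.ofReal_mul (gaussianPDFReal_nonneg _ _ _),
    gaussianPDFReal_mul_exp_gaussianLogRatio hv hw]

theorem lintegral_prod_exp_gaussianLogRatio {v w : ℝ≥0} (hv : v ≠ 0) (hw : w ≠ 0) (a : ℝ)
    (ν : Measure ℝ) [IsProbabilityMeasure ν] :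
    ∫⁻ p, ENNReal.ofReal (Real.exp (gaussianLogRatio v w (a * p.2) p.1))
      ∂((gaussianReal 0 v).prod ν) = 1 := by
  rw [lintegral_prod_symm' _ (by unfold gaussianLogRatio; fun_prop)]
  simp [lintegral_exp_gaussianLogRatio hv hw]

theorem integrable_prod_exp_gaussianLogRatio {v w : ℝ≥0} (hv : v ≠ 0) (hw : w ≠ 0) (a : ℝ)
    (ν : Measure ℝ) [IsProbabilityMeasure ν] :
    Integrable (fun p : ℝ × ℝ ↦ Real.exp (gaussianLogRatio v w (a * p.2) p.1))
      ((gaussianReal 0 v).prod ν) := by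
  refine ⟨by unfold gaussianLogRatio; fun_prop, ?_⟩
  rw [hasFiniteIntegral_iff_ofReal (.of_forall fun _ ↦ (Real.exp_pos _).le),
    lintegral_prod_exp_gaussianLogRatio hv hw]
  exact ENNReal.one_lt_top

theorem integral_prod_exp_gaussianLogRatio {v w : ℝ≥0} (hv : v ≠ 0) (hw : w ≠ 0) (a : ℝ)
    (ν : Measure ℝ) [IsProbabilityMeasure ν] :
    ∫ p, Real.exp (gaussianLogRatio v w (a * p.2) p.1) ∂((gaussianReal 0 v).prod ν) = 1 := by
  rw [integral_eq_lintegral_of_nonneg_ae (.of_forall fun _ ↦ (Real.exp_pos _).le)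
    (integrable_prod_exp_gaussianLogRatio hv hw a ν).aestronglyMeasurable,
    lintegral_prod_exp_gaussianLogRatio hv hw, ENNReal.toReal_one]

/-- An unbiased estimate `Y` of `X` satisfies `E[X Y] = E[X²]`. -/
theorem integral_mul_eq_integral_sq_of_condExp_eq {Ω : Type*} [MeasurableSpace Ω]
    {P : Measure Ω} [IsProbabilityMeasure P] {X Y : Ω → ℝ} (hXm : Measurable X)
    (hX : MemLp X 2 P) (hY : MemLp Y 2 P)
    (h : P[Y | MeasurableSpace.comap X inferInstance] =ᵐ[P] X) :
    ∫ ω, X ω * Y ω ∂P = ∫ ω, X ω ^ 2 ∂P := by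
  have hpull := condExp_mul_of_stronglyMeasurable_left (μ := P)
    (comap_measurable X).stronglyMeasurable (hX.integrable_mul hY)
    (hY.integrable one_le_two)
  calc ∫ ω, X ω * Y ω ∂P
      = ∫ ω, (P[X * Y | MeasurableSpace.comap X inferInstance]) ω ∂P :=
        (integral_condExp hXm.comap_le).symm
    _ = ∫ ω, X ω ^ 2 ∂P := by
        refine integral_congr_ae ?_
        filter_upwards [hpull, h] with ω h1 h2
        rw [h1, Pi.mul_apply, h2, sq]

/-- Unbiased single-letter converse bound: if `X` is Gaussian with mean `0` and
variance `σ²`, `E[X̂ | X] = X` a.s., and `E[(X̂ - X)²] ≤ D`, then the mutual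
information `I(X; X̂)` (KL divergence of the joint law from the product of the
marginals) is at least `(1/2) ln(1 + σ²/D)`. -/
theorem stmt_6 {Ω : Type*} [MeasureSpace Ω] [IsProbabilityMeasure (ℙ : Measure Ω)]
    (σ2 D : ℝ) (hσ : 0 < σ2) (hD : 0 < D)
    (X Xhat : Ω → ℝ) (hXm : Measurable X) (hXhatm : Measurable Xhat)
    (hgauss : Measure.map X ℙ = gaussianReal 0 ⟨σ2, hσ.le⟩)
    (hL2 : MemLp Xhat 2 ℙ)
    (hunbiased : ℙ[Xhat | MeasurableSpace.comap X
      (inferInstance : MeasurableSpace ℝ)] =ᵐ[ℙ] X)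
    (hvar : ∫ ω, (Xhat ω - X ω) ^ 2 ∂ℙ ≤ D) :
    (((1 / 2 : ℝ) * Real.log (1 + σ2 / D) : ℝ) : EReal) ≤
      klDiv (Measure.map (fun ω => (X ω, Xhat ω)) ℙ)
        ((Measure.map X ℙ).prod (Measure.map Xhat ℙ)) := by
  unfold klDiv
  split_ifs with hkl
  swap
  · exact le_top
  obtain ⟨hac, hint⟩ := hkl
  rw [EReal.coe_le_coe_iff]
  set v : ℝ≥0 := ⟨σ2, hσ.le⟩
  have hvc : (v : ℝ) = σ2 := rfl
  have hv : v ≠ 0 := by rw [← NNReal.coe_ne_zero, hvc]; exact hσ.ne'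
  have hw0 : 0 < σ2 * D / (σ2 + D) := by positivity
  set w : ℝ≥0 := ⟨σ2 * D / (σ2 + D), hw0.le⟩
  have hwc : (w : ℝ) = σ2 * D / (σ2 + D) := rfl
  have hw : w ≠ 0 := by rw [← NNReal.coe_ne_zero, hwc]; exact hw0.ne'
  have hXY : Measurable fun ω ↦ (X ω, Xhat ω) := hXm.prodMk hXhatm
  have := Measure.isProbabilityMeasure_map (μ := (ℙ : Measure Ω)) hXm.aemeasurable
  have := Measure.isProbabilityMeasure_map (μ := (ℙ : Measure Ω)) hXhatm.aemeasurable
  have := Measure.isProbabilityMeasure_map (μ := (ℙ : Measure Ω)) hXY.aemeasurable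
  have hX : MemLp X 2 ℙ := by
    have h := memLp_id_gaussianReal' (μ := 0) (v := v) 2 (by simp)
    rw [← hgauss] at h
    exact h.comp_of_map hXm.aemeasurable
  have hX2 : ∫ ω, X ω ^ 2 ∂ℙ = σ2 := by
    have hmean : ∫ x, x ∂(gaussianReal 0 v) = 0 := integral_id_gaussianReal
    have h := variance_id_gaussianReal (μ := 0) (v := v)
    rw [variance_of_integral_eq_zero aemeasurable_id hmean, ← hgauss,
      integral_map hXm.aemeasurable (by fun_prop)] at h
    simpa [hvc] using h
  have hcross := integral_mul_eq_integral_sq_of_condExp_eq hXm hX hL2 hunbiased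
  have hiX : Integrable (fun ω ↦ X ω ^ 2) ℙ := hX.integrable_sq
  have hiY : Integrable (fun ω ↦ Xhat ω ^ 2) ℙ := hL2.integrable_sq
  have hiXY : Integrable (fun ω ↦ X ω * Xhat ω) ℙ := hX.integrable_mul hL2
  set a : ℝ := σ2 / (σ2 + D) with ha
  have hquad (b c : ℝ) : Integrable (fun ω ↦ (b * X ω - c * Xhat ω) ^ 2) ℙ ∧
      ∫ ω, (b * X ω - c * Xhat ω) ^ 2 ∂ℙ =
        (b ^ 2 - 2 * b * c) * σ2 + c ^ 2 * ∫ ω, Xhat ω ^ 2 ∂ℙ := by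
    have he : (fun ω ↦ (b * X ω - c * Xhat ω) ^ 2) = fun ω ↦
        b ^ 2 * X ω ^ 2 - 2 * b * c * (X ω * Xhat ω) + c ^ 2 * Xhat ω ^ 2 := by
      ext ω; ring
    rw [he]
    have hi : Integrable (fun ω ↦ b ^ 2 * X ω ^ 2 - 2 * b * c * (X ω * Xhat ω)) ℙ :=
      (hiX.const_mul _).sub (hiXY.const_mul _)
    refine ⟨hi.add (hiY.const_mul _), ?_⟩
    rw [integral_add hi (hiY.const_mul _),
      integral_sub (hiX.const_mul _) (hiXY.const_mul _)]
    simp only [integral_const_mul]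
    rw [hcross, hX2]; ring
  have hY2 : ∫ ω, Xhat ω ^ 2 ∂ℙ ≤ σ2 + D := by
    have h := (hquad 1 1).2
    have he : ∫ ω, (1 * X ω - 1 * Xhat ω) ^ 2 ∂ℙ = ∫ ω, (Xhat ω - X ω) ^ 2 ∂ℙ :=
      integral_congr_ae (.of_forall fun ω ↦ by ring)
    linarith
  have hres : ∫ ω, (1 * X ω - a * Xhat ω) ^ 2 ∂ℙ ≤ (w : ℝ) := by
    rw [(hquad 1 a).2, hwc]
    calc (1 ^ 2 - 2 * 1 * a) * σ2 + a ^ 2 * ∫ ω, Xhat ω ^ 2 ∂ℙ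
        ≤ (1 ^ 2 - 2 * 1 * a) * σ2 + a ^ 2 * (σ2 + D) := by gcongr
      _ = σ2 * D / (σ2 + D) := by rw [ha]; field_simp; ring
  let f : ℝ × ℝ → ℝ := fun p ↦ gaussianLogRatio v w (a * p.2) p.1
  have hfm : Measurable f := by unfold f gaussianLogRatio; fun_prop
  have hfcomp : (fun ω ↦ f (X ω, Xhat ω)) = fun ω ↦ Real.log (v / w) / 2
      - (1 * X ω - a * Xhat ω) ^ 2 / (2 * w) + X ω ^ 2 / (2 * v) := by
    ext ω; simp only [f, gaussianLogRatio, one_mul]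
  have hi1 : Integrable (fun ω ↦ Real.log (v / w) / 2
      - (1 * X ω - a * Xhat ω) ^ 2 / (2 * w)) ℙ :=
    (integrable_const _).sub ((hquad 1 a).1.div_const _)
  have hfμ : Integrable f (Measure.map (fun ω ↦ (X ω, Xhat ω)) ℙ) := by
    rw [integrable_map_measure hfm.aestronglyMeasurable hXY.aemeasurable]
    change Integrable (fun ω ↦ f (X ω, Xhat ω)) ℙ
    rw [hfcomp]
    exact hi1.add (hiX.div_const _)
  have hfν := integrable_prod_exp_gaussianLogRatio hv hw a (Measure.map Xhat ℙ)
  have hfν1 := integral_prod_exp_gaussianLogRatio hv hw a (Measure.map Xhat ℙ)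
  rw [← hgauss] at hfν hfν1
  have hdv := integral_sub_log_integral_exp_le_integral_llr hac hint hfμ hfν
  rw [hfν1, Real.log_one, sub_zero] at hdv
  refine le_trans ?_ hdv
  rw [integral_map hXY.aemeasurable hfm.aestronglyMeasurable, hfcomp,
    integral_add hi1 (hiX.div_const _),
    integral_sub (integrable_const _) ((hquad 1 a).1.div_const _), integral_div, integral_div,
    integral_div, hX2, integral_const, probReal_univ, one_smul, hvc]
  have hratio : σ2 / (w : ℝ) = 1 + σ2 / D := by rw [hwc]; field_simp; ring
  have hhalf : σ2 / (2 * σ2) = 1 / 2 := by field_simp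
  have hbound : (∫ ω, (1 * X ω - a * Xhat ω) ^ 2 ∂ℙ) / (2 * (w : ℝ)) ≤ 1 / 2 := by
    rw [div_le_iff₀ (by rw [hwc]; positivity)]
    linarith
  rw [hratio, hhalf]
  linarith
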